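/- (Maximal weight characterization of ballistic deposition.) Let H : ℤ^d → ℤ be any initial condition and u = (u_1, …, u_n) an update list. Define the ballistic deposition heights g_0, …, g_n by g_0 = H and, for 1 ≤ k ≤ n, g_k agrees with g_{k−1} except at u_k, where g_k(u_k) = 1 + max over n ∈ N₀ of g_{k−1}(u_k + n). Then for every x ∈ ℤ^d, g_n(x) equals the maximum of W(γ) + H(γ(0)) over all lattice paths γ for u starting at x. -/

import Mathlib

open Classical MeasureTheory

noncomputable section

/-- The set `N` of nearest neighbors of the origin in `ℤ^d`. -/
def nbr (d : ℕ) : Set (Fin d → ℤ) :=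
  {v | ∃ i : Fin d, v = Pi.single i 1 ∨ v = Pi.single i (-1)}

/-- The set `N₀` of nearest neighbors of the origin, together with the origin. -/
def nbr0 (d : ℕ) : Set (Fin d → ℤ) := nbr d ∪ {0}

/-- One RSOS update at site `x`: the height at `x` increases by one iff it is
no larger than all neighboring heights. -/
def rsosStep {d : ℕ} (f : (Fin d → ℤ) → ℤ) (x : Fin d → ℤ) : (Fin d → ℤ) → ℤ :=
  fun y => if y = x ∧ ∀ e ∈ nbr d, f x ≤ f (x + e) then f x + 1 else f y

/-- RSOS heights after applying the update list `u` (in chronological order)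
to the initial condition `H`. -/
def RSOS {d : ℕ} (u : List (Fin d → ℤ)) (H : (Fin d → ℤ) → ℤ) : (Fin d → ℤ) → ℤ :=
  u.foldl rsosStep H

/-- A lattice path for the update list `u` starting at `x`:
`γ n = x` (where `n = u.length`) and for every `1 ≤ k ≤ n` (indexed here by `k+1`
with `k < n`), either the path stays, or the `k`-th update occurs at the path's
position and the path moves to a nearest neighbor (backwards in time). -/
def IsLatticePath {d : ℕ} (u : List (Fin d → ℤ)) (x : Fin d → ℤ) (γ : ℕ → (Fin d → ℤ)) : Prop :=
  γ u.length = x ∧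
    ∀ k < u.length, γ k = γ (k + 1) ∨ (γ (k + 1) = u.getD k 0 ∧ γ k - γ (k + 1) ∈ nbr d)

/-- The weight of a lattice path: the number of indices `1 ≤ j ≤ n` with `γ j = u_j`. -/
def pathWeight {d : ℕ} (u : List (Fin d → ℤ)) (γ : ℕ → (Fin d → ℤ)) : ℕ :=
  ((Finset.range u.length).filter fun k => γ (k + 1) = u.getD k 0).card

/-- The ℓ¹ norm on `ℤ^d`. -/
def l1 {d : ℕ} (v : Fin d → ℤ) : ℕ := ∑ i, (v i).natAbs

/-- One ballistic deposition update at site `x`: the height at `x` becomes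
`1 + max over n ∈ N₀ of f (x + n)` (the `sSup` is a true maximum, as `N₀` is
finite and nonempty). -/
def bdStep {d : ℕ} (f : (Fin d → ℤ) → ℤ) (x : Fin d → ℤ) : (Fin d → ℤ) → ℤ :=
  fun y => if y = x then 1 + sSup ((fun n => f (x + n)) '' nbr0 d) else f y

/-- Ballistic deposition heights after applying the update list `u` to `H`. -/
def BD {d : ℕ} (u : List (Fin d → ℤ)) (H : (Fin d → ℤ) → ℤ) : (Fin d → ℤ) → ℤ :=
  u.foldl bdStep H

theorem nbr0_finite (d : ℕ) : (nbr0 d).Finite := by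
  unfold nbr0
  refine Set.Finite.union ?_ (Set.finite_singleton 0)
  have h : nbr d ⊆ (Set.range fun i : Fin d => (Pi.single i 1 : Fin d → ℤ)) ∪
      (Set.range fun i : Fin d => (Pi.single i (-1) : Fin d → ℤ)) := by
    rintro v ⟨i, h | h⟩
    · exact Or.inl ⟨i, h.symm⟩
    · exact Or.inr ⟨i, h.symm⟩
  exact ((Set.finite_range _).union (Set.finite_range _)).subset h

theorem isGreatest_nbr0 {d : ℕ} (f : (Fin d → ℤ) → ℤ) (x : Fin d → ℤ) :
    IsGreatest ((fun n => f (x + n)) '' nbr0 d) (sSup ((fun n => f (x + n)) '' nbr0 d)) := by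
  have hf : ((fun n => f (x + n)) '' nbr0 d).Finite := (nbr0_finite d).image _
  have hne : ((fun n => f (x + n)) '' nbr0 d).Nonempty :=
    ⟨_, ⟨0, Or.inr rfl, rfl⟩⟩
  exact ⟨Int.csSup_mem hne hf.bddAbove, fun y hy => le_csSup hf.bddAbove hy⟩

theorem pathWeight_append {d : ℕ} (u : List (Fin d → ℤ)) (a : Fin d → ℤ)
    (γ : ℕ → (Fin d → ℤ)) :
    pathWeight (u ++ [a]) γ = pathWeight u γ + if γ (u.length + 1) = a then 1 else 0 := by
  unfold pathWeight
  simp only [Finset.card_filter, List.length_append, List.length_singleton,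
    Finset.sum_range_succ]
  congr 1
  · refine Finset.sum_congr rfl fun k hk => ?_
    rw [List.getD_append _ _ _ _ (Finset.mem_range.1 hk)]
  · simp

theorem isLatticePath_append {d : ℕ} (u : List (Fin d → ℤ)) (a x : Fin d → ℤ)
    (γ : ℕ → (Fin d → ℤ)) :
    IsLatticePath (u ++ [a]) x γ ↔ IsLatticePath u (γ u.length) γ ∧ γ (u.length + 1) = x ∧
      (γ u.length = x ∨ (x = a ∧ γ u.length - x ∈ nbr d)) := by
  unfold IsLatticePath
  simp only [List.length_append, List.length_singleton]
  constructor
  · rintro ⟨h1, h2⟩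
    refine ⟨⟨trivial, fun k hk => ?_⟩, h1, ?_⟩
    · have := h2 k (by omega)
      rwa [List.getD_append _ _ _ _ hk] at this
    · have := h2 u.length (by omega)
      rw [h1] at this
      simpa using this
  · rintro ⟨⟨-, h2⟩, h1, h3⟩
    refine ⟨h1, fun k hk => ?_⟩
    rcases Nat.lt_succ_iff_lt_or_eq.1 hk with hk | rfl
    · rw [List.getD_append _ _ _ _ hk]
      exact h2 k hk
    · rw [h1]
      simpa using h3

theorem path_congr {d : ℕ} (u : List (Fin d → ℤ)) (y : Fin d → ℤ)
    (γ γ' : ℕ → (Fin d → ℤ)) (h : ∀ k ≤ u.length, γ' k = γ k) (hp : IsLatticePath u y γ) :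
    IsLatticePath u y γ' ∧ pathWeight u γ' = pathWeight u γ := by
  refine ⟨⟨(h _ le_rfl).trans hp.1, fun k hk => ?_⟩, ?_⟩
  · rw [h k hk.le, h (k + 1) hk]
    exact hp.2 k hk
  · unfold pathWeight
    congr 1
    refine Finset.filter_congr fun k hk => ?_
    rw [h (k + 1) (Finset.mem_range.1 hk)]

theorem bd_isGreatest {d : ℕ} (H : (Fin d → ℤ) → ℤ) (u : List (Fin d → ℤ)) :
    ∀ x : Fin d → ℤ, IsGreatest {w : ℤ | ∃ γ : ℕ → (Fin d → ℤ), IsLatticePath u x γ ∧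
      w = (pathWeight u γ : ℤ) + H (γ 0)} (BD u H x) := by
  induction u using List.reverseRecOn with
  | nil =>
    intro x
    constructor
    · exact ⟨fun _ => x, ⟨rfl, by simp⟩, by simp [BD, pathWeight]⟩
    · rintro w ⟨γ, ⟨h, -⟩, rfl⟩
      simp only [List.length_nil] at h
      simp [BD, pathWeight, h]
  | append_singleton u a ih =>
    intro x
    have hBD : BD (u ++ [a]) H = bdStep (BD u H) a := by simp [BD]
    -- extension of an optimal path by one final position
    have key : ∀ y, (y = x ∨ (x = a ∧ y - x ∈ nbr d)) →
        ∃ γ, IsLatticePath (u ++ [a]) x γ ∧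
          BD u H y + (if x = a then 1 else 0) = (pathWeight (u ++ [a]) γ : ℤ) + H (γ 0) := by
      intro y hy
      obtain ⟨γ, hγ, hw⟩ := (ih y).1
      let γ' : ℕ → (Fin d → ℤ) := fun k => if k ≤ u.length then γ k else x
      have hc : ∀ k ≤ u.length, γ' k = γ k := fun k hk => if_pos hk
      have hl : γ' (u.length + 1) = x := if_neg (by omega)
      obtain ⟨hp, hwt⟩ := path_congr u y γ γ' hc hγ
      have hy' : γ' u.length = y := hp.1
      refine ⟨γ', ?_, ?_⟩
      · rw [isLatticePath_append, hy']
        exact ⟨hp, hl, hy⟩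
      · rw [pathWeight_append, hl, hwt, hc 0 (Nat.zero_le _), hw]
        push_cast
        ring
    obtain ⟨hmem, hub⟩ := isGreatest_nbr0 (BD u H) a
    rw [hBD]
    constructor
    · by_cases hxa : x = a
      · subst hxa
        obtain ⟨n, hn, hs⟩ := hmem
        obtain ⟨γ, h1, h2⟩ := key (x + n) (by
          rcases hn with hn | hn
          · right; simpa using hn
          · left; simp only [Set.mem_singleton_iff] at hn; simp [hn])
        refine ⟨γ, h1, ?_⟩
        rw [← h2]
        simp only [bdStep, if_true]
        rw [← hs]
        ring
      · obtain ⟨γ, h1, h2⟩ := key x (Or.inl rfl)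
        refine ⟨γ, h1, ?_⟩
        rw [← h2]
        simp [bdStep, hxa]
    · rintro w ⟨γ, hγ, rfl⟩
      rw [isLatticePath_append] at hγ
      obtain ⟨hp, hl, hy⟩ := hγ
      have hle := (ih (γ u.length)).2 ⟨γ, hp, rfl⟩
      rw [pathWeight_append, hl]
      by_cases hxa : x = a
      · subst hxa
        have hn : γ u.length - x ∈ nbr0 d := by
          rcases hy with hy | hy
          · right; simp [hy]
          · exact Or.inl hy.2
        have h2 := hub ⟨_, hn, rfl⟩
        simp only [add_sub_cancel] at h2
        simp only [bdStep, if_true]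
        push_cast
        linarith
      · rcases hy with hy | hy
        · rw [hy] at hle
          simpa [bdStep, hxa] using hle
        · exact absurd hy.1 hxa

/-- maximal weight characterization of ballistic deposition: for any
initial condition `H`, the BD height at `x` equals the maximum of `W(γ) + H(γ 0)`
over all lattice paths `γ` for `u` starting at `x`. -/
theorem bd_eq_max_weight {d : ℕ} (hd : 1 ≤ d) (H : (Fin d → ℤ) → ℤ)
    (u : List (Fin d → ℤ)) (x : Fin d → ℤ) :
    BD u H x = sSup {w : ℤ | ∃ γ : ℕ → (Fin d → ℤ), IsLatticePath u x γ ∧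
      w = (pathWeight u γ : ℤ) + H (γ 0)} := by
  exact ((bd_isGreatest H u x).csSup_eq).symm

end
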